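/- Let (Ω,μ) be a measure space, m ∈ (0,1), T > 0, c1, c̄ > 0, Φ1 : Ω → [0,∞) measurable, and u : [0,T]×Ω → [0,∞) measurable. Assume: (i) for all 0 < t0 < t1 ≤ T and μ-a.e. x ∈ Ω, u(t1,x)^m ≤ (c1/(1-m)) · Φ1(x) · (ess sup_x u(t0,x)) · t1^(m/(1-m)) / (t1^(1/(1-m)) − t0^(1/(1-m))); (ii) for all t0 ∈ [T/2, T], ess sup_x u(t0,x) ≤ c̄ · (T − t0)^(1/(1-m)). Then for every t ∈ [2T/3, T] and μ-a.e. x ∈ Ω: u(t,x)^m ≤ 2^(1 + m/(1-m)) · (3/2)^(1/(1-m)) · c1 · c̄ · Φ1(x) · (T − t)^(m/(1-m)). -/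

import Mathlib

open Real Set MeasureTheory

theorem conv_aux (p s t : ℝ) (hp : 1 ≤ p) (hs : 0 < s) (hst : s < t) :
    p * s ^ (p - 1) * (t - s) ≤ t ^ p - s ^ p := by
  have hb := one_add_mul_self_le_rpow_one_add (s := (t - s) / s)
    (by have : 0 ≤ (t - s) / s := div_nonneg (by linarith) hs.le
        linarith) hp
  have h1 : 1 + (t - s) / s = t / s := by field_simp; ring
  rw [h1, Real.div_rpow (by linarith) hs.le, le_div_iff₀ (Real.rpow_pos_of_pos hs p)] at hb
  have h2 : s ^ p = s ^ (p - 1) * s := by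
    rw [Real.rpow_sub_one hs.ne']; field_simp
  have h3 : (1 + p * ((t - s) / s)) * s ^ p = s ^ p + p * s ^ (p - 1) * (t - s) := by
    have : p * ((t - s) / s) * s ^ p = p * s ^ (p - 1) * (t - s) := by
      rw [h2]; field_simp
    rw [add_mul, this, one_mul]
  linarith

theorem step_aux (m T c1 cbar φ E U t0 t1 : ℝ) (hm : m ∈ Set.Ioo (0:ℝ) 1) (hT : 0 < T)
    (hc1 : 0 < c1) (hcbar : 0 < cbar) (hφ : 0 ≤ φ) (h0 : T / 2 ≤ t0) (h01 : t0 < t1) (h1 : t1 ≤ T)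
    (hU : U ≤ (c1/(1-m)) * φ * E * t1 ^ (m/(1-m)) / (t1 ^ (1/(1-m)) - t0 ^ (1/(1-m))))
    (hE : E ≤ cbar * (T - t0) ^ (1/(1-m))) :
    U ≤ 2 ^ (m/(1-m)) * c1 * cbar * φ * (T - t0) ^ (1/(1-m)) / (t1 - t0) := by
  obtain ⟨hm0, hm1⟩ := hm
  have hq : 0 < 1 - m := by linarith
  have ht0 : 0 < t0 := by linarith
  have hp : 1 / (1 - m) - 1 = m / (1 - m) := by field_simp; ring
  have ha : 0 < m / (1 - m) := div_pos hm0 hq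
  have hc := conv_aux (1/(1-m)) t0 t1 (by linarith) ht0 h01
  rw [hp] at hc
  have hd : 0 < t1 - t0 := by linarith
  have hA : 0 < t0 ^ (m/(1-m)) := Real.rpow_pos_of_pos ht0 _
  have hpos : 0 < 1 / (1-m) * t0 ^ (m/(1-m)) * (t1 - t0) := by positivity
  have hB : t1 ^ (m/(1-m)) ≤ 2 ^ (m/(1-m)) * t0 ^ (m/(1-m)) := by
    rw [← Real.mul_rpow (by norm_num) ht0.le]
    exact Real.rpow_le_rpow (by linarith) (by linarith) ha.le
  have hR : 0 ≤ (T - t0) ^ (1/(1-m)) := Real.rpow_nonneg (by linarith) _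
  have hB0 : 0 ≤ t1 ^ (m/(1-m)) := Real.rpow_nonneg (by linarith) _
  have hk : 0 ≤ c1 / (1-m) * φ := by positivity
  refine hU.trans ?_
  calc _ ≤ (c1/(1-m)) * φ * (cbar * (T - t0) ^ (1/(1-m))) * (2 ^ (m/(1-m)) * t0 ^ (m/(1-m)))
        / (t1 ^ (1/(1-m)) - t0 ^ (1/(1-m))) := by
        apply div_le_div_of_nonneg_right _ (by linarith)
        exact mul_le_mul (mul_le_mul_of_nonneg_left hE hk) hB hB0 (by positivity)
    _ ≤ (c1/(1-m)) * φ * (cbar * (T - t0) ^ (1/(1-m))) * (2 ^ (m/(1-m)) * t0 ^ (m/(1-m)))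
        / (1 / (1-m) * t0 ^ (m/(1-m)) * (t1 - t0)) :=
        div_le_div_of_nonneg_left (by positivity) hpos hc
    _ = _ := by
        generalize (T - t0) ^ (1/(1-m)) = R
        generalize t0 ^ (m/(1-m)) = A at *
        generalize (2:ℝ) ^ (m/(1-m)) = B
        field_simp

/-- Upper boundary estimates up to the extinction time for `m > m_{c,1}`. -/
theorem stmt_13 {Ω : Type*} [MeasurableSpace Ω] (μ : Measure Ω)
    (m T c1 cbar : ℝ) (hm : m ∈ Set.Ioo (0:ℝ) 1) (hT : 0 < T)
    (hc1 : 0 < c1) (hcbar : 0 < cbar)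
    (Φ1 : Ω → ℝ) (hΦ1_meas : Measurable Φ1) (hΦ1_nonneg : ∀ x, 0 ≤ Φ1 x)
    (u : ℝ → Ω → ℝ) (hu_meas : Measurable (Function.uncurry u))
    (hu_nonneg : ∀ t x, 0 ≤ u t x)
    (hi : ∀ t0 t1 : ℝ, 0 < t0 → t0 < t1 → t1 ≤ T → ∀ᵐ x ∂μ,
      u t1 x ^ m ≤ (c1/(1-m)) * Φ1 x * essSup (u t0) μ * t1 ^ (m/(1-m))
        / (t1 ^ (1/(1-m)) - t0 ^ (1/(1-m))))
    (hii : ∀ t0 : ℝ, T/2 ≤ t0 → t0 ≤ T →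
      essSup (u t0) μ ≤ cbar * (T - t0) ^ (1/(1-m))) :
    ∀ t : ℝ, 2*T/3 ≤ t → t ≤ T → ∀ᵐ x ∂μ,
      u t x ^ m ≤ (2:ℝ) ^ (1 + m/(1-m)) * (3/2 : ℝ) ^ (1/(1-m)) * c1 * cbar
        * Φ1 x * (T - t) ^ (m/(1-m)) := by
  intro t ht htT
  have hq : 0 < 1 - m := by linarith [hm.2]
  have ha : 0 < m / (1 - m) := div_pos hm.1 hq
  have hp : 1 / (1 - m) = m / (1 - m) + 1 := by field_simp; ring
  rcases htT.lt_or_eq with hlt | rfl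
  · have hd : 0 < T - t := by linarith
    filter_upwards [hi (t - (T - t) / 2) t (by linarith) (by linarith) htT] with x hx
    have h := step_aux m T c1 cbar (Φ1 x) _ _ _ _ hm hT hc1 hcbar (hΦ1_nonneg x) (by linarith)
      (by linarith) htT hx (hii _ (by linarith) (by linarith))
    refine h.trans (le_of_eq ?_)
    have e1 : T - (t - (T - t) / 2) = 3 / 2 * (T - t) := by ring
    have e2 : t - (t - (T - t) / 2) = (T - t) / 2 := by ring
    have e3 : (T - t) ^ (1 / (1 - m)) = (T - t) ^ (m / (1 - m)) * (T - t) := by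
      rw [hp, Real.rpow_add_one hd.ne']
    rw [e1, e2, Real.mul_rpow (by norm_num) hd.le, e3, Real.rpow_add (by norm_num), Real.rpow_one]
    generalize (T - t) ^ (m/(1-m)) = R
    generalize (3 / 2 : ℝ) ^ (1/(1-m)) = A
    generalize (2:ℝ) ^ (m/(1-m)) = B
    field_simp
  · have hall : ∀ n : ℕ, ∀ᵐ x ∂μ, u t x ^ m ≤
        2 ^ (m/(1-m)) * c1 * cbar * Φ1 x * (t / 2 * (1 / ((n:ℝ) + 1))) ^ (m/(1-m)) := by
      intro n
      have hn : 0 < 1 / ((n:ℝ) + 1) := by positivity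
      have hn1 : 1 / ((n:ℝ) + 1) ≤ 1 := by
        rw [div_le_one (by positivity)]; linarith [(Nat.cast_nonneg n : (0:ℝ) ≤ n)]
      set d := t / 2 * (1 / ((n:ℝ) + 1)) with hdd
      have hd : 0 < d := by positivity
      have hd1 : d ≤ t / 2 := by rw [hdd]; nlinarith
      filter_upwards [hi (t - d) t (by linarith) (by linarith) le_rfl] with x hx
      have h := step_aux m t c1 cbar (Φ1 x) _ _ _ _ hm hT hc1 hcbar (hΦ1_nonneg x) (by linarith)
        (by linarith) le_rfl hx (hii _ (by linarith) (by linarith))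
      refine h.trans (le_of_eq ?_)
      rw [sub_sub_cancel, hp, Real.rpow_add_one hd.ne']
      generalize d ^ (m/(1-m)) = R
      field_simp
    filter_upwards [ae_all_iff.2 hall] with x hx
    rw [sub_self]
    have h0 : Filter.Tendsto (fun n : ℕ => t / 2 * (1 / ((n:ℝ) + 1))) Filter.atTop (nhds 0) := by
      simpa using (tendsto_one_div_add_atTop_nhds_zero_nat (𝕜 := ℝ)).const_mul (t / 2)
    have h1 := (h0.rpow_const (p := m/(1-m)) (Or.inr ha.le)).const_mul
      (2 ^ (m/(1-m)) * c1 * cbar * Φ1 x)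
    have h2 := ge_of_tendsto' h1 hx
    rw [Real.zero_rpow ha.ne', mul_zero] at h2 ⊢
    exact h2
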